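/- arXiv:1411.3939 — 3 statements merged into one kernel-verified Lean document; each statement's English description precedes it below -/
import Mathlib

section
/- Let h : ℝ → [0,∞) be measurable and let ι : (0,∞) → [0,∞) be nondecreasing such that for every τ > 0 the Lebesgue measure of {ξ ∈ ℝ : h(ξ) < τ} is at most ι(τ). Then ∫_ℝ e^{−h(ξ)²} dξ ≤ ∫₀^∞ 2τ e^{−τ²} ι(τ) dτ. -/
open MeasureTheory
open scoped ENNReal

theorem lintegral_Ioi_two_mul_mul_exp_neg_sq {a : ℝ} (ha : 0 ≤ a) :
    ∫⁻ τ in Set.Ioi a, ENNReal.ofReal (2 * τ * Real.exp (-τ ^ 2)) =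
      ENNReal.ofReal (Real.exp (-a ^ 2)) := by
  have hderiv : ∀ x ∈ Set.Ici a,
      HasDerivAt (fun τ : ℝ => -Real.exp (-τ ^ 2)) (2 * x * Real.exp (-x ^ 2)) x := by
    intro x _
    refine ((hasDerivAt_pow 2 x).fun_neg.exp).fun_neg.congr_deriv ?_
    push_cast
    ring
  have hpos : ∀ x ∈ Set.Ioi a, 0 ≤ 2 * x * Real.exp (-x ^ 2) := by
    intro x hx
    have : 0 < x := ha.trans_lt hx
    positivity
  have hlim : Filter.Tendsto (fun τ : ℝ => -Real.exp (-τ ^ 2)) Filter.atTop (nhds 0) := by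
    simpa using (Real.tendsto_exp_atBot.comp (Filter.tendsto_neg_atTop_atBot.comp
      (Filter.tendsto_pow_atTop (α := ℝ) two_ne_zero))).neg
  rw [← ofReal_integral_eq_lintegral_ofReal
    (integrableOn_Ioi_deriv_of_nonneg' hderiv hpos hlim)
    ((ae_restrict_iff' measurableSet_Ioi).2 (.of_forall hpos)),
    integral_Ioi_of_hasDerivAt_of_nonneg' hderiv hpos hlim]
  simp

/-- layer-cake estimate.
If `h : ℝ → [0,∞)` is measurable and `|{ξ : h ξ < τ}| ≤ ι τ` for a nondecreasing
`ι : (0,∞) → [0,∞)`, then `∫ e^{-h²} ≤ ∫₀^∞ 2τ e^{-τ²} ι(τ) dτ`. -/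
theorem stmt_2 (h : ℝ → ℝ) (hmeas : Measurable h) (hnonneg : ∀ ξ : ℝ, 0 ≤ h ξ)
    (ι : ℝ → ℝ) (hι_nonneg : ∀ τ : ℝ, 0 < τ → 0 ≤ ι τ)
    (hι_mono : ∀ τ₁ τ₂ : ℝ, 0 < τ₁ → τ₁ ≤ τ₂ → ι τ₁ ≤ ι τ₂)
    (hcond : ∀ τ : ℝ, 0 < τ → volume {ξ : ℝ | h ξ < τ} ≤ ENNReal.ofReal (ι τ)) :
    ∫⁻ ξ : ℝ, ENNReal.ofReal (Real.exp (-(h ξ) ^ 2))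
      ≤ ∫⁻ τ in Set.Ioi (0 : ℝ), ENNReal.ofReal (2 * τ * Real.exp (-τ ^ 2) * ι τ) := by
  have hswap : ∫⁻ ξ : ℝ, ENNReal.ofReal (Real.exp (-(h ξ) ^ 2)) =
      ∫⁻ τ in Set.Ioi (0 : ℝ),
        ENNReal.ofReal (2 * τ * Real.exp (-τ ^ 2)) * volume {ξ : ℝ | h ξ < τ} := by
    have hmeas_prod : Measurable (fun p : ℝ × ℝ => {q : ℝ × ℝ | h q.1 < q.2}.indicator
        (fun q => ENNReal.ofReal (2 * q.2 * Real.exp (-q.2 ^ 2))) p) :=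
      Measurable.indicator (by fun_prop)
        (measurableSet_lt (hmeas.comp measurable_fst) measurable_snd)
    calc ∫⁻ ξ : ℝ, ENNReal.ofReal (Real.exp (-(h ξ) ^ 2))
        = ∫⁻ ξ : ℝ, ∫⁻ τ in Set.Ioi (0 : ℝ), {q : ℝ × ℝ | h q.1 < q.2}.indicator
            (fun q => ENNReal.ofReal (2 * q.2 * Real.exp (-q.2 ^ 2))) (ξ, τ) := by
          refine lintegral_congr fun ξ => ?_
          rw [← lintegral_Ioi_two_mul_mul_exp_neg_sq (hnonneg ξ),
            ← Set.inter_eq_left.2 (Set.Ioi_subset_Ioi (hnonneg ξ)),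
            ← setLIntegral_indicator measurableSet_Ioi]
          rfl
      _ = ∫⁻ τ in Set.Ioi (0 : ℝ), ∫⁻ ξ : ℝ, {q : ℝ × ℝ | h q.1 < q.2}.indicator
            (fun q => ENNReal.ofReal (2 * q.2 * Real.exp (-q.2 ^ 2))) (ξ, τ) :=
          lintegral_lintegral_swap hmeas_prod.aemeasurable
      _ = _ := by
          refine lintegral_congr fun τ => ?_
          rw [← lintegral_indicator_const (measurableSet_lt hmeas measurable_const)]
          rfl
  rw [hswap]
  refine setLIntegral_mono' measurableSet_Ioi fun τ hτ => ?_
  have hτ_pos : 0 < τ := hτ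
  rw [ENNReal.ofReal_mul (p := 2 * τ * Real.exp (-τ ^ 2)) (by positivity)]
  gcongr
  exact hcond τ hτ_pos
end

section
/- Let l ≥ 1 be an integer and define a : ℝ → ℝ² by a(ξ) = (ξ^l, ξ^l). Then there exists a constant C > 0 such that for every unit vector σ = (σ₁, σ₂) ∈ ℝ², every z ∈ ℝ² and every ε > 0, the Lebesgue measure of {ξ ∈ ℝ : |a(ξ)σ − z| ≤ ε} is at most C ε^{1/l}, where a(ξ)σ denotes the coordinatewise product (ξ^l σ₁, ξ^l σ₂) and |·| the Euclidean norm on ℝ². -/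
open MeasureTheory
open scoped ENNReal

/-- For two reals of the same sign, the distance of the `l`-th powers dominates the `l`-th power of
the distance. -/
lemma abs_sub_pow_le_abs_pow_sub_pow {l : ℕ} (hl : l ≠ 0) {x y : ℝ}
    (hxy : 0 ≤ x ∧ 0 ≤ y ∨ x ≤ 0 ∧ y ≤ 0) :
    |x - y| ^ l ≤ |x ^ l - y ^ l| := by
  have key : ∀ a b : ℝ, 0 ≤ b → b ≤ a → |a - b| ^ l ≤ |a ^ l - b ^ l| := by
    intro a b hb hab
    have h := pow_add_pow_le (sub_nonneg.2 hab) hb hl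
    rw [sub_add_cancel] at h
    rw [abs_of_nonneg (sub_nonneg.2 hab)]
    exact (le_sub_iff_add_le.2 h).trans (le_abs_self _)
  have nonneg : ∀ a b : ℝ, 0 ≤ a → 0 ≤ b → |a - b| ^ l ≤ |a ^ l - b ^ l| := by
    intro a b ha hb
    rcases le_total b a with hab | hab
    · exact key a b hb hab
    · rw [abs_sub_comm a b, abs_sub_comm (a ^ l)]
      exact key b a ha hab
  rcases hxy with ⟨hx, hy⟩ | ⟨hx, hy⟩
  · exact nonneg x y hx hy
  · have h := nonneg (-x) (-y) (neg_nonneg.2 hx) (neg_nonneg.2 hy)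
    rwa [neg_pow x, neg_pow y, ← mul_sub, abs_mul, abs_neg_one_pow, one_mul, neg_sub_neg,
      abs_sub_comm y x] at h

/-- A set of reals of constant sign whose `l`-th powers lie within `ε` of a point has measure at
most `(2 ε) ^ (1 / l)`. -/
lemma volume_le_of_abs_pow_sub_le {l : ℕ} (hl : l ≠ 0) {w ε : ℝ} (hε : 0 ≤ ε) {s : Set ℝ}
    (hs : ∀ x ∈ s, |x ^ l - w| ≤ ε) (hsign : (∀ x ∈ s, 0 ≤ x) ∨ ∀ x ∈ s, x ≤ 0) :
    volume s ≤ ENNReal.ofReal ((2 * ε) ^ ((1 : ℝ) / l)) := by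
  refine (Real.volume_le_diam s).trans (Metric.ediam_le fun x hx y hy => ?_)
  rw [edist_dist, Real.dist_eq]
  refine ENNReal.ofReal_le_ofReal ?_
  have hpow : |x - y| ^ l ≤ 2 * ε := calc
    |x - y| ^ l ≤ |x ^ l - y ^ l| := abs_sub_pow_le_abs_pow_sub_pow hl
      (hsign.imp (fun h => ⟨h x hx, h y hy⟩) fun h => ⟨h x hx, h y hy⟩)
    _ ≤ |x ^ l - w| + |w - y ^ l| := abs_sub_le _ _ _
    _ ≤ 2 * ε := by
      rw [abs_sub_comm w]
      linarith [hs x hx, hs y hy]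
  rw [one_div, Real.le_rpow_inv_iff_of_pos (abs_nonneg _) (by positivity) (by positivity),
    Real.rpow_natCast]
  exact hpow

/-- The distance of `t σ` to `z`, for `σ` a unit vector, dominates the distance of `t` to the
coefficient of the projection of `z` on `σ`. -/
lemma abs_sub_inner_le_sqrt {σ : ℝ × ℝ} (hσ : σ.1 ^ 2 + σ.2 ^ 2 = 1) (z : ℝ × ℝ) (t : ℝ) :
    |t - (σ.1 * z.1 + σ.2 * z.2)| ≤
      Real.sqrt ((t * σ.1 - z.1) ^ 2 + (t * σ.2 - z.2) ^ 2) := by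
  refine Real.abs_le_sqrt ?_
  have h : (t * σ.1 - z.1) ^ 2 + (t * σ.2 - z.2) ^ 2 =
      (t - (σ.1 * z.1 + σ.2 * z.2)) ^ 2 + (σ.1 * z.2 - σ.2 * z.1) ^ 2 := by
    linear_combination (t ^ 2 - z.1 ^ 2 - z.2 ^ 2) * hσ
  rw [h]
  exact le_add_of_nonneg_right (sq_nonneg _)

/-- the stochastic genuine nonlinearity condition (flux) holds with
exponent `θ = 1/l` for `a(ξ) = (ξ^l, ξ^l)`. There is `C > 0` such that for every unit vector
`σ = (σ₁, σ₂) ∈ ℝ²`, every `z ∈ ℝ²` and every `ε > 0`,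
`|{ξ : |a(ξ)σ - z| ≤ ε}| ≤ C ε^{1/l}`, where `a(ξ)σ = (ξ^l σ₁, ξ^l σ₂)` is the coordinatewise
product and `|·|` the Euclidean norm on `ℝ²`. -/
theorem stmt_8 (l : ℕ) (hl : 1 ≤ l) :
    ∃ C : ℝ, 0 < C ∧
      ∀ σ : ℝ × ℝ, σ.1 ^ 2 + σ.2 ^ 2 = 1 → ∀ (z : ℝ × ℝ) (ε : ℝ), 0 < ε →
        volume {ξ : ℝ | Real.sqrt ((ξ ^ l * σ.1 - z.1) ^ 2 + (ξ ^ l * σ.2 - z.2) ^ 2) ≤ ε}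
          ≤ ENNReal.ofReal (C * ε ^ ((1 : ℝ) / l)) := by
  have hl0 : l ≠ 0 := Nat.one_le_iff_ne_zero.1 hl
  refine ⟨2 * 2 ^ ((1 : ℝ) / l), by positivity, fun σ hσ z ε hε => ?_⟩
  set s := {ξ : ℝ | Real.sqrt ((ξ ^ l * σ.1 - z.1) ^ 2 + (ξ ^ l * σ.2 - z.2) ^ 2) ≤ ε}
  have hs : ∀ x ∈ s, |x ^ l - (σ.1 * z.1 + σ.2 * z.2)| ≤ ε := fun x hx =>
    (abs_sub_inner_le_sqrt hσ z (x ^ l)).trans hx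
  have hpos := volume_le_of_abs_pow_sub_le (s := s ∩ Set.Ici 0) hl0 hε.le
    (fun x hx => hs x hx.1) (.inl fun x hx => hx.2)
  have hneg := volume_le_of_abs_pow_sub_le (s := s ∩ Set.Iic 0) hl0 hε.le
    (fun x hx => hs x hx.1) (.inr fun x hx => hx.2)
  have hcover : s = s ∩ Set.Ici 0 ∪ s ∩ Set.Iic 0 := by
    rw [← Set.inter_union_distrib_left, Set.union_comm, Set.Iic_union_Ici, Set.inter_univ]
  calc volume s = volume (s ∩ Set.Ici 0 ∪ s ∩ Set.Iic 0) := congrArg _ hcover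
    _ ≤ volume (s ∩ Set.Ici 0) + volume (s ∩ Set.Iic 0) := measure_union_le _ _
    _ ≤ _ := add_le_add hpos hneg
    _ = ENNReal.ofReal (2 * 2 ^ ((1 : ℝ) / l) * ε ^ ((1 : ℝ) / l)) := by
      rw [← ENNReal.ofReal_add (by positivity) (by positivity),
        Real.mul_rpow zero_le_two hε.le, ← two_mul, mul_assoc]
end

section
/- Let N ≥ 1, and for j = 1,…,N let a_j : ℝ → ℝ be measurable, θ_j ∈ (0,1] and C > 0 be such that for every z ∈ ℝ and every ε > 0 the Lebesgue measure of {ξ ∈ ℝ : |a_j(ξ) − z| ≤ ε} is at most C ε^{θ_j}. Set θ := min(θ₁,…,θ_N) and a := (a₁,…,a_N) : ℝ → ℝ^N. Then there exists a constant C′ > 0 such that for every unit vector σ ∈ ℝ^N, every z ∈ ℝ^N and every ε ∈ (0,1], the Lebesgue measure of {ξ ∈ ℝ : |a(ξ)σ − z| ≤ ε} is at most C′ ε^θ, where a(ξ)σ denotes the coordinatewise product (a₁(ξ)σ₁,…,a_N(ξ)σ_N) and |·| the Euclidean norm on ℝ^N. -/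
open MeasureTheory
open scoped ENNReal

/-- Some coordinate of a unit vector in dimension `N` has absolute value at least `1 / N`. -/
theorem exists_one_le_card_mul_abs {N : ℕ} {σ : Fin N → ℝ} (hσ : ∑ i, σ i ^ 2 = 1) :
    ∃ j, 1 ≤ (N : ℝ) * |σ j| := by
  by_contra! h
  have hN : (1 : ℝ) ≤ N := by
    rcases N with _ | n
    · simp at hσ
    · simp
  have hlt : ∀ i, (N : ℝ) * σ i ^ 2 < 1 := fun i ↦ by
    rw [← sq_abs]
    nlinarith [h i, abs_nonneg (σ i)]
  have hne : (Finset.univ : Finset (Fin N)).Nonempty := by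
    by_contra hempty
    simp [Finset.not_nonempty_iff_eq_empty.mp hempty] at hσ
  have := Finset.sum_lt_sum_of_nonempty hne fun i _ ↦ hlt i
  simp [← Finset.mul_sum, hσ] at this

/-- A bound on the Euclidean norm bounds each coordinate. -/
theorem abs_le_of_sqrt_sum_sq_le {ι : Type*} [Fintype ι] {v : ι → ℝ} {ε : ℝ}
    (h : √(∑ i, v i ^ 2) ≤ ε) (j : ι) : |v j| ≤ ε :=
  (Real.abs_le_sqrt (Finset.single_le_sum (f := fun i ↦ v i ^ 2)
    (fun i _ ↦ sq_nonneg (v i)) (Finset.mem_univ j))).trans h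

/-- If `1 ≤ M * |s|`, then dividing `|x * s - z| ≤ ε` by `|s|` costs at most a factor `M`. -/
theorem abs_sub_div_le_mul {M s x z ε : ℝ} (hs : 1 ≤ M * |s|) (h : |x * s - z| ≤ ε) :
    |x - z / s| ≤ M * ε := by
  have hs0 : s ≠ 0 := by
    rintro rfl
    norm_num at hs
  have heq : |x * s - z| = |x - z / s| * |s| := by
    rw [← abs_mul, sub_mul, div_mul_cancel₀ _ hs0]
  have hpos := abs_pos.mpr hs0
  have hM : 0 < M := pos_of_mul_pos_left (one_pos.trans_le hs) hpos.le
  calc |x - z / s| ≤ |x - z / s| * (M * |s|) := le_mul_of_one_le_right (abs_nonneg _) hs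
    _ = M * |x * s - z| := by rw [heq]; ring
    _ ≤ M * ε := by gcongr

/-- if each one-dimensional component flux derivative `a_j` satisfies the
nonlinearity condition with exponent `θ_j`, then the vector flux `a = (a₁,…,a_N)` satisfies
the stochastic genuine nonlinearity condition (flux) with exponent `θ = min_j θ_j`:
there is `C' > 0` such that for every unit vector `σ ∈ ℝ^N`, every `z ∈ ℝ^N` and every
`ε ∈ (0,1]`, `|{ξ : |a(ξ)σ - z| ≤ ε}| ≤ C' ε^θ`, where `a(ξ)σ` is the coordinatewise product
and `|·|` the Euclidean norm. -/
theorem stmt_9 (N : ℕ) (hN : 1 ≤ N) (a : Fin N → ℝ → ℝ) (hmeas : ∀ j, Measurable (a j))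
    (θ : Fin N → ℝ) (hθ : ∀ j, 0 < θ j ∧ θ j ≤ 1) (C : ℝ) (hC : 0 < C)
    (hcond : ∀ j, ∀ (z ε : ℝ), 0 < ε →
      volume {ξ : ℝ | |a j ξ - z| ≤ ε} ≤ ENNReal.ofReal (C * ε ^ θ j))
    (θmin : ℝ) (hmin : IsLeast (Set.range θ) θmin) :
    ∃ C' : ℝ, 0 < C' ∧
      ∀ σ : Fin N → ℝ, ∑ i, σ i ^ 2 = 1 →
        ∀ (z : Fin N → ℝ) (ε : ℝ), 0 < ε → ε ≤ 1 →
          volume {ξ : ℝ | Real.sqrt (∑ i, (a i ξ * σ i - z i) ^ 2) ≤ ε}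
            ≤ ENNReal.ofReal (C' * ε ^ θmin) := by
  have hN1 : (1 : ℝ) ≤ N := by exact_mod_cast hN
  refine ⟨C * N, by positivity, fun σ hσ z ε hε hε1 ↦ ?_⟩
  obtain ⟨j, hj⟩ := exists_one_le_card_mul_abs hσ
  have hsub : {ξ : ℝ | √(∑ i, (a i ξ * σ i - z i) ^ 2) ≤ ε} ⊆
      {ξ : ℝ | |a j ξ - z j / σ j| ≤ N * ε} := fun ξ hξ ↦
    abs_sub_div_le_mul hj (abs_le_of_sqrt_sum_sq_le hξ j)
  refine (measure_mono hsub).trans ((hcond j _ _ (by positivity)).trans ?_)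
  apply ENNReal.ofReal_le_ofReal
  rw [Real.mul_rpow (by positivity) hε.le, mul_assoc]
  gcongr C * (?_ * ?_)
  · exact Real.rpow_le_self_of_one_le hN1 (hθ j).2
  · exact Real.rpow_le_rpow_of_exponent_ge hε hε1 (hmin.2 ⟨j, rfl⟩)
end
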